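/- Let f : [a,b] → X have the property S*HK on [a,b], let Z₁ = { t₁ ∈ [a₁,b₁] : the section f_{t₁} does not have the property S*HK on [a₂,b₂] }, Z₂ = { t₂ ∈ [a₂,b₂] : the section f_{t₂} does not have the property S*HK on [a₁,b₁] }, Z = (Z₁ × [a₂,b₂]) ∪ ([a₁,b₁] × Z₂), and f₀ = f·𝟙_{[a,b]∖Z}. Then f₀ is strongly Henstock–Kurzweil integrable on [a,b], and for every t₁ ∈ [a₁,b₁] the section (f₀)_{t₁} is strongly Henstock–Kurzweil integrable on [a₂,b₂] and for every t₂ ∈ [a₂,b₂] the section (f₀)_{t₂} is strongly Henstock–Kurzweil integrable on [a₁,b₁]. -/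

import Mathlib

open Set MeasureTheory

variable {E : Type*} [MeasureSpace E] [PseudoMetricSpace E] [Preorder E]
variable {X : Type*} [NormedAddCommGroup X] [NormedSpace ℝ X]

/-- The closed interval of a tagged item `(t, p, q)` is `[p, q]` (the tag is `t`). -/
def itemBox (x : E × E × E) : Set E := Set.Icc x.2.1 x.2.2

/-- `[p,q]` is a closed non-degenerate subinterval of `K`. -/
def IsSubinterval (K : Set E) (p q : E) : Prop :=
  Set.Icc p q ⊆ K ∧ (interior (Set.Icc p q)).Nonempty

/-- `P` is an `𝓜`-partition of `K`: a finite collection of tagged pairwise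
non-overlapping closed non-degenerate subintervals of `K` covering `K`, with tags in `K`. -/
def IsMPartition (K : Set E) (P : Finset (E × E × E)) : Prop :=
  (∀ x ∈ P, x.1 ∈ K ∧ IsSubinterval K x.2.1 x.2.2) ∧
  (∀ x ∈ P, ∀ y ∈ P, x ≠ y → interior (itemBox x) ∩ interior (itemBox y) = ∅) ∧
  (⋃ x ∈ P, itemBox x) = K

/-- `𝓗𝓚`-partition: an `𝓜`-partition each of whose tags belongs to its interval. -/
def IsHKPartition (K : Set E) (P : Finset (E × E × E)) : Prop :=
  IsMPartition K P ∧ ∀ x ∈ P, x.1 ∈ itemBox x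

/-- A gauge on `K`: positive on `K`. -/
def IsGauge (K : Set E) (δ : E → ℝ) : Prop := ∀ t ∈ K, 0 < δ t

/-- A tagged partition is `δ`-fine if each interval lies in the open ball
around its tag of radius `δ(tag)`. -/
def IsFine (δ : E → ℝ) (P : Finset (E × E × E)) : Prop :=
  ∀ x ∈ P, itemBox x ⊆ Metric.ball x.1 (δ x.1)

/-- `f` is McShane integrable on `K` with integral `v`. -/
def HasMcShaneIntegral (K : Set E) (f : E → X) (v : X) : Prop :=
  ∀ ε > 0, ∃ δ : E → ℝ, IsGauge K δ ∧
    ∀ P : Finset (E × E × E), IsMPartition K P → IsFine δ P →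
      ‖(∑ x ∈ P, (volume (itemBox x)).toReal • f x.1) - v‖ < ε

/-- `f` is Henstock–Kurzweil integrable on `K` with integral `v`. -/
def HasHKIntegral (K : Set E) (f : E → X) (v : X) : Prop :=
  ∀ ε > 0, ∃ δ : E → ℝ, IsGauge K δ ∧
    ∀ P : Finset (E × E × E), IsHKPartition K P → IsFine δ P →
      ‖(∑ x ∈ P, (volume (itemBox x)).toReal • f x.1) - v‖ < ε

/-- An additive interval function on the non-degenerate closed subintervals of `K`
(an interval is recorded by its pair of corners). -/
def IsAdditiveIntervalFun (K : Set E) (F : E × E → X) : Prop :=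
  ∀ p q r s u w : E, IsSubinterval K p q → IsSubinterval K r s → IsSubinterval K u w →
    interior (Set.Icc p q) ∩ interior (Set.Icc r s) = ∅ →
    Set.Icc p q ∪ Set.Icc r s = Set.Icc u w →
    F (u, w) = F (p, q) + F (r, s)

/-- `f` is strongly McShane integrable on `[a,b]` with `(M)∫_{[a,b]} f = v`. -/
def HasStrongMcShaneIntegral (a b : E) (f : E → X) (v : X) : Prop :=
  ∃ F : E × E → X, IsAdditiveIntervalFun (Set.Icc a b) F ∧ F (a, b) = v ∧
    ∀ ε > 0, ∃ δ : E → ℝ, IsGauge (Set.Icc a b) δ ∧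
      ∀ P : Finset (E × E × E), IsMPartition (Set.Icc a b) P → IsFine δ P →
        ∑ x ∈ P, ‖(volume (itemBox x)).toReal • f x.1 - F (x.2.1, x.2.2)‖ < ε

/-- `f` is strongly Henstock–Kurzweil integrable on `[a,b]` with `(HK)∫_{[a,b]} f = v`. -/
def HasStrongHKIntegral (a b : E) (f : E → X) (v : X) : Prop :=
  ∃ F : E × E → X, IsAdditiveIntervalFun (Set.Icc a b) F ∧ F (a, b) = v ∧
    ∀ ε > 0, ∃ δ : E → ℝ, IsGauge (Set.Icc a b) δ ∧
      ∀ P : Finset (E × E × E), IsHKPartition (Set.Icc a b) P → IsFine δ P →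
        ∑ x ∈ P, ‖(volume (itemBox x)).toReal • f x.1 - F (x.2.1, x.2.2)‖ < ε

/-- Property `𝓢*𝓜` on `[a,b]`. -/
def PropSM (a b : E) (f : E → X) : Prop :=
  ∀ ε > 0, ∃ δ : E → ℝ, IsGauge (Set.Icc a b) δ ∧
    ∀ P Q : Finset (E × E × E),
      IsMPartition (Set.Icc a b) P → IsFine δ P →
      IsMPartition (Set.Icc a b) Q → IsFine δ Q →
      ∑ x ∈ P, ∑ y ∈ Q, ‖f x.1 - f y.1‖ * (volume (itemBox x ∩ itemBox y)).toReal < ε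

/-- Property `𝓢*𝓗𝓚` on `[a,b]`. -/
def PropSHK (a b : E) (f : E → X) : Prop :=
  ∀ ε > 0, ∃ δ : E → ℝ, IsGauge (Set.Icc a b) δ ∧
    ∀ P Q : Finset (E × E × E),
      IsHKPartition (Set.Icc a b) P → IsFine δ P →
      IsHKPartition (Set.Icc a b) Q → IsFine δ Q →
      ∑ x ∈ P, ∑ y ∈ Q, ‖f x.1 - f y.1‖ * (volume (itemBox x ∩ itemBox y)).toReal < ε


set_option linter.unusedSectionVars false

open Filter Topology

section Partitions

variable {V : Type*} [MeasureSpace V] [PseudoMetricSpace V] [Preorder V]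

lemma IsMPartition.tag_mem {K : Set V} {P : Finset (V × V × V)} (hP : IsMPartition K P)
    {x : V × V × V} (hx : x ∈ P) : x.1 ∈ K := (hP.1 x hx).1

lemma IsMPartition.itemBox_subset {K : Set V} {P : Finset (V × V × V)} (hP : IsMPartition K P)
    {x : V × V × V} (hx : x ∈ P) : itemBox x ⊆ K := (hP.1 x hx).2.1

lemma IsGauge.min {K : Set V} {δ η : V → ℝ} (hδ : IsGauge K δ) (hη : IsGauge K η) :
    IsGauge K (fun t => min (δ t) (η t)) := fun t ht => lt_min (hδ t ht) (hη t ht)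

lemma IsFine.mono {δ η : V → ℝ} {P : Finset (V × V × V)} (hP : IsFine δ P)
    (h : ∀ t, δ t ≤ η t) : IsFine η P :=
  fun x hx => (hP x hx).trans (Metric.ball_subset_ball (h _))

/-- Every gauge on `K` admits a fine Henstock–Kurzweil partition of `K`. -/
def HasFinePartitions (K : Set V) : Prop :=
  ∀ δ : V → ℝ, IsGauge K δ → ∃ P : Finset (V × V × V), IsHKPartition K P ∧ IsFine δ P

/-- The filter of Henstock–Kurzweil partitions of `K` that become fine for every gauge. -/
def gaugeFilter (K : Set V) : Filter (Finset (V × V × V)) :=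
  ⨅ δ ∈ {δ : V → ℝ | IsGauge K δ}, 𝓟 {P | IsHKPartition K P ∧ IsFine δ P}

lemma hasBasis_gaugeFilter (K : Set V) :
    (gaugeFilter K).HasBasis (fun δ => δ ∈ {δ : V → ℝ | IsGauge K δ})
      (fun δ => {P | IsHKPartition K P ∧ IsFine δ P}) := by
  refine hasBasis_biInf_principal ?_ ⟨fun _ => 1, fun _ _ => one_pos⟩
  intro δ hδ η hη
  exact ⟨_, IsGauge.min hδ hη, fun P hP => ⟨hP.1, hP.2.mono fun _ => min_le_left _ _⟩,
    fun P hP => ⟨hP.1, hP.2.mono fun _ => min_le_right _ _⟩⟩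

lemma HasFinePartitions.neBot_gaugeFilter {K : Set V} (hK : HasFinePartitions K) :
    (gaugeFilter K).NeBot :=
  (hasBasis_gaugeFilter K).neBot_iff.2 fun {δ} hδ => hK δ hδ

end Partitions

section FiniteDimensional

variable {V : Type*} [NormedAddCommGroup V] [NormedSpace ℝ V] [FiniteDimensional ℝ V]
  [MeasureSpace V] [BorelSpace V] [(volume : Measure V).IsAddHaarMeasure]
  [PartialOrder V] [IsOrderedAddMonoid V] [PosSMulMono ℝ V] [OrderClosedTopology V]
  [CompactIccSpace V]

lemma aedisjoint_Icc {p q r s : V}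
    (h : interior (Set.Icc p q) ∩ interior (Set.Icc r s) = ∅) :
    AEDisjoint volume (Set.Icc p q) (Set.Icc r s) := by
  have h0 : ∀ p q : V, volume (frontier (Set.Icc p q)) = 0 := fun p q =>
    (convex_Icc (𝕜 := ℝ) p q).addHaar_frontier volume
  refine measure_mono_null ?_ (measure_union_null (h0 p q) (h0 r s))
  rintro x ⟨hx, hy⟩
  by_contra hn
  simp only [Set.mem_union, frontier, isClosed_Icc.closure_eq, Set.mem_sdiff, not_or, not_and,
    not_not] at hn
  have : x ∈ interior (Set.Icc p q) ∩ interior (Set.Icc r s) := ⟨hn.1 hx, hn.2 hy⟩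
  simp [h] at this

lemma measurableSet_itemBox (x : V × V × V) : MeasurableSet (itemBox x) :=
  isClosed_Icc.measurableSet

lemma volume_itemBox_ne_top (x : V × V × V) : volume (itemBox x) ≠ ⊤ :=
  (isCompact_Icc.measure_lt_top).ne

lemma IsMPartition.pairwise_aedisjoint {K : Set V} {P : Finset (V × V × V)}
    (hP : IsMPartition K P) :
    (P : Set (V × V × V)).Pairwise (Function.onFun (AEDisjoint volume) itemBox) :=
  fun x hx y hy hxy => aedisjoint_Icc (hP.2.1 x hx y hy hxy)

lemma IsMPartition.sum_volume_inter {K A : Set V} {P : Finset (V × V × V)}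
    (hP : IsMPartition K P) (hA : MeasurableSet A) (hAK : A ⊆ K) :
    ∑ x ∈ P, (volume (A ∩ itemBox x)).toReal = (volume A).toReal := by
  rw [← ENNReal.toReal_sum
    fun x _ => measure_ne_top_of_subset Set.inter_subset_right (volume_itemBox_ne_top x),
    ← measure_biUnion_finset₀, ← Set.inter_iUnion₂, hP.2.2, Set.inter_eq_left.2 hAK]
  · exact fun x hx y hy hxy => (hP.pairwise_aedisjoint hx hy hxy).mono Set.inter_subset_right
      Set.inter_subset_right
  · exact fun x _ => (hA.inter (measurableSet_itemBox x)).nullMeasurableSet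

variable {Y : Type*} [NormedAddCommGroup Y] [NormedSpace ℝ Y]

/-- The Riemann sum of `f` over the tagged partition `P`, localized to the set `A`. -/
noncomputable def localRiemannSum (f : V → Y) (A : Set V) (P : Finset (V × V × V)) : Y :=
  ∑ x ∈ P, (volume (A ∩ itemBox x)).toReal • f x.1

lemma smul_sub_localRiemannSum {K A : Set V} {P : Finset (V × V × V)} (hP : IsMPartition K P)
    (hA : MeasurableSet A) (hAK : A ⊆ K) (f : V → Y) (t : V) :
    (volume A).toReal • f t - localRiemannSum f A P =
      ∑ y ∈ P, (volume (A ∩ itemBox y)).toReal • (f t - f y.1) := by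
  simp only [smul_sub, Finset.sum_sub_distrib, localRiemannSum, ← Finset.sum_smul,
    hP.sum_volume_inter hA hAK]

lemma norm_smul_sub_localRiemannSum_le {K A : Set V} {P : Finset (V × V × V)}
    (hP : IsMPartition K P) (hA : MeasurableSet A) (hAK : A ⊆ K) (f : V → Y) (t : V) :
    ‖(volume A).toReal • f t - localRiemannSum f A P‖ ≤
      ∑ y ∈ P, ‖f t - f y.1‖ * (volume (A ∩ itemBox y)).toReal := by
  rw [smul_sub_localRiemannSum hP hA hAK]
  refine (norm_sum_le _ _).trans (Finset.sum_le_sum fun y _ => ?_)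
  rw [norm_smul, Real.norm_of_nonneg ENNReal.toReal_nonneg, mul_comm]

lemma localRiemannSum_eq_sum {K A : Set V} {P Q : Finset (V × V × V)} (hP : IsMPartition K P)
    (hA : MeasurableSet A) (hAK : A ⊆ K) (f : V → Y) :
    localRiemannSum f A Q = ∑ x ∈ P, localRiemannSum f (A ∩ itemBox x) Q := by
  simp only [localRiemannSum]
  rw [Finset.sum_comm]
  refine Finset.sum_congr rfl fun y _ => ?_
  rw [← Finset.sum_smul]
  congr 1
  rw [← hP.sum_volume_inter (hA.inter (measurableSet_itemBox y))
    (Set.inter_subset_left.trans hAK)]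
  simp only [Set.inter_right_comm]

lemma norm_localRiemannSum_sub_le {K A : Set V} {P Q : Finset (V × V × V)}
    (hP : IsMPartition K P) (hQ : IsMPartition K Q)
    (hA : MeasurableSet A) (hAK : A ⊆ K) (f : V → Y) :
    ‖localRiemannSum f A P - localRiemannSum f A Q‖ ≤
      ∑ x ∈ P, ∑ y ∈ Q, ‖f x.1 - f y.1‖ * (volume (itemBox x ∩ itemBox y)).toReal := by
  rw [localRiemannSum_eq_sum hP hA hAK f (Q := Q), localRiemannSum, ← Finset.sum_sub_distrib]
  refine (norm_sum_le _ _).trans (Finset.sum_le_sum fun x _ => ?_)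
  refine (norm_smul_sub_localRiemannSum_le hQ (hA.inter (measurableSet_itemBox x))
    (Set.inter_subset_left.trans hAK) f x.1).trans (Finset.sum_le_sum fun y _ => ?_)
  have : (volume (A ∩ itemBox x ∩ itemBox y)).toReal ≤
      (volume (itemBox x ∩ itemBox y)).toReal := by
    refine ENNReal.toReal_mono
      (measure_ne_top_of_subset Set.inter_subset_left (volume_itemBox_ne_top x)) ?_
    exact measure_mono (Set.inter_subset_inter_left _ Set.inter_subset_right)
  gcongr

lemma localRiemannSum_union {A B : Set V} (hB : MeasurableSet B)
    (hAB : AEDisjoint volume A B) (f : V → Y) (P : Finset (V × V × V)) :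
    localRiemannSum f (A ∪ B) P = localRiemannSum f A P + localRiemannSum f B P := by
  simp only [localRiemannSum, ← Finset.sum_add_distrib, ← add_smul]
  refine Finset.sum_congr rfl fun x _ => ?_
  congr 1
  rw [Set.union_inter_distrib_right, measure_union₀
    (hB.inter (measurableSet_itemBox x)).nullMeasurableSet
    (hAB.mono Set.inter_subset_left Set.inter_subset_left), ENNReal.toReal_add]
  all_goals exact measure_ne_top_of_subset Set.inter_subset_right (volume_itemBox_ne_top x)

lemma PropSHK.exists_tendsto_localRiemannSum [CompleteSpace Y] {a b : V} {f : V → Y}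
    (hK : HasFinePartitions (Set.Icc a b)) (hf : PropSHK a b f) {A : Set V}
    (hA : MeasurableSet A) (hAK : A ⊆ Set.Icc a b) :
    ∃ v, Tendsto (localRiemannSum f A) (gaugeFilter (Set.Icc a b)) (𝓝 v) := by
  have := hK.neBot_gaugeFilter
  refine CompleteSpace.complete (Metric.cauchy_iff.2 ⟨inferInstance, fun ε hε => ?_⟩)
  obtain ⟨δ, hδ, h⟩ := hf ε hε
  refine ⟨_, image_mem_map ((hasBasis_gaugeFilter _).mem_of_mem hδ), ?_⟩
  rintro _ ⟨P, hP, rfl⟩ _ ⟨Q, hQ, rfl⟩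
  rw [dist_eq_norm]
  exact (norm_localRiemannSum_sub_le hP.1.1 hQ.1.1 hA hAK f).trans_lt (h P Q hP.1 hP.2 hQ.1 hQ.2)

theorem PropSHK.exists_hasStrongHKIntegral [CompleteSpace Y] {a b : V} {f : V → Y}
    (hK : HasFinePartitions (Set.Icc a b)) (hf : PropSHK a b f) :
    ∃ v, HasStrongHKIntegral a b f v := by
  have := hK.neBot_gaugeFilter
  set G := gaugeFilter (Set.Icc a b)
  let F : V × V → Y := fun p => limUnder G (localRiemannSum f (Set.Icc p.1 p.2))
  have hF : ∀ p q : V, Set.Icc p q ⊆ Set.Icc a b →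
      Tendsto (localRiemannSum f (Set.Icc p q)) G (𝓝 (F (p, q))) := fun p q h =>
    tendsto_nhds_limUnder (hf.exists_tendsto_localRiemannSum hK isClosed_Icc.measurableSet h)
  refine ⟨F (a, b), F, ?_, rfl, fun ε hε => ?_⟩
  · intro p q r s u w h₁ h₂ h₃ hd hu
    refine tendsto_nhds_unique (hF u w h₃.1) (((hF p q h₁.1).add (hF r s h₂.1)).congr fun P => ?_)
    rw [← hu, localRiemannSum_union isClosed_Icc.measurableSet
      (aedisjoint_Icc hd)]
  · obtain ⟨δ, hδ, h⟩ := hf (ε / 2) (half_pos hε)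
    refine ⟨δ, hδ, fun P hP hPδ => lt_of_le_of_lt ?_ (half_lt_self hε)⟩
    have hlim : Tendsto (fun Q => ∑ x ∈ P,
        ‖(volume (itemBox x)).toReal • f x.1 - localRiemannSum f (itemBox x) Q‖) G
        (𝓝 (∑ x ∈ P, ‖(volume (itemBox x)).toReal • f x.1 - F (x.2.1, x.2.2)‖)) :=
      tendsto_finsetSum _ fun x hx =>
        ((tendsto_const_nhds.sub (hF x.2.1 x.2.2 (hP.1.itemBox_subset hx))).norm)
    refine le_of_tendsto hlim (mem_of_superset ((hasBasis_gaugeFilter _).mem_of_mem hδ) ?_)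
    intro Q hQ
    exact (Finset.sum_le_sum fun x hx => norm_smul_sub_localRiemannSum_le hQ.1.1
      (measurableSet_itemBox x) (hP.1.itemBox_subset hx) f x.1).trans
      (h P Q hP hPδ hQ.1 hQ.2).le

lemma exists_gauge_sum_le_of_null {N : Set V} (hN : volume N = 0) (φ : V → NNReal)
    (hφ : ∀ t ∉ N, φ t = 0) {ε : ℝ} (hε : 0 < ε) :
    ∃ δ : V → ℝ, (∀ t, 0 < δ t) ∧ ∀ (K : Set V) (P : Finset (V × V × V)), IsMPartition K P →
      IsFine δ P → ∑ x ∈ P, (volume (itemBox x)).toReal * φ x.1 ≤ ε := by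
  have hφ0 : φ =ᵐ[volume] 0 :=
    measure_mono_null (fun t ht => by_contra fun h => ht (hφ t h)) hN
  obtain ⟨g, hg, hlsc, hg_int⟩ := exists_lt_lowerSemicontinuous_lintegral_ge_of_aemeasurable volume φ
    (aemeasurable_const.congr hφ0.symm) (ENNReal.ofReal_pos.2 hε).ne'
  have hg_int' : ∫⁻ x, g x ≤ ENNReal.ofReal ε := by
    have h0 : ∫⁻ x, (φ x : ENNReal) = 0 := by
      rw [lintegral_congr_ae (g := fun _ => 0) (hφ0.mono fun x hx => by simp [hx])]
      simp
    simpa [h0] using hg_int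
  have hball : ∀ t, ∃ δ > 0, ∀ y ∈ Metric.ball t δ, (φ t : ENNReal) < g y := fun t =>
    Metric.eventually_nhds_iff_ball.1 (hlsc t _ (hg t))
  choose δ hδ hδg using hball
  refine ⟨δ, hδ, fun K P hP hfine => ?_⟩
  have key : ∑ x ∈ P, volume (itemBox x) * φ x.1 ≤ ENNReal.ofReal ε :=
    calc ∑ x ∈ P, volume (itemBox x) * φ x.1
        ≤ ∑ x ∈ P, ∫⁻ y in itemBox x, g y := by
          refine Finset.sum_le_sum fun x hx => ?_
          rw [mul_comm, ← setLIntegral_const]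
          exact setLIntegral_mono' (measurableSet_itemBox x)
            fun y hy => (hδg x.1 y (hfine x hx hy)).le
      _ = ∫⁻ y in ⋃ x ∈ P, itemBox x, g y :=
          (lintegral_biUnion_finset₀ hP.pairwise_aedisjoint
            (fun x _ => (measurableSet_itemBox x).nullMeasurableSet) g).symm
      _ ≤ ∫⁻ y, g y := setLIntegral_le_lintegral _ _
      _ ≤ ENNReal.ofReal ε := hg_int'
  have := ENNReal.toReal_le_of_le_ofReal hε.le key
  rw [ENNReal.toReal_sum
    fun x _ => ENNReal.mul_ne_top (volume_itemBox_ne_top x) ENNReal.coe_ne_top] at this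
  simpa [ENNReal.toReal_mul] using this

theorem HasStrongHKIntegral.congr_of_null {a b : V} {f g : V → Y} {v : Y}
    (hf : HasStrongHKIntegral a b f v) {N : Set V} (hN : volume N = 0)
    (hfg : ∀ t ∈ Set.Icc a b \ N, g t = f t) : HasStrongHKIntegral a b g v := by
  obtain ⟨F, hF, hv, h⟩ := hf
  refine ⟨F, hF, hv, fun ε hε => ?_⟩
  obtain ⟨δ, hδ, hδf⟩ := h (ε / 2) (half_pos hε)
  obtain ⟨η, hη, hηφ⟩ := exists_gauge_sum_le_of_null hN
    ((Set.Icc a b).indicator fun t => ‖g t - f t‖₊)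
    (fun t ht => by
      by_cases hK : t ∈ Set.Icc a b
      · simp [hK, hfg t ⟨hK, ht⟩]
      · simp [hK]) (half_pos hε)
  refine ⟨_, IsGauge.min hδ (fun t _ => hη t), fun P hP hfine => ?_⟩
  have h₁ := hδf P hP (hfine.mono fun _ => min_le_left _ _)
  have h₂ := hηφ _ P hP.1 (hfine.mono fun _ => min_le_right _ _)
  calc ∑ x ∈ P, ‖(volume (itemBox x)).toReal • g x.1 - F (x.2.1, x.2.2)‖
      ≤ ∑ x ∈ P, (‖(volume (itemBox x)).toReal • f x.1 - F (x.2.1, x.2.2)‖ +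
          (volume (itemBox x)).toReal *
            ((Set.Icc a b).indicator (fun t => ‖g t - f t‖₊) x.1 : NNReal)) := by
        refine Finset.sum_le_sum fun x hx => ?_
        rw [Set.indicator_of_mem (hP.1.tag_mem hx), coe_nnnorm]
        calc _ = ‖((volume (itemBox x)).toReal • f x.1 - F (x.2.1, x.2.2)) +
              (volume (itemBox x)).toReal • (g x.1 - f x.1)‖ := by rw [smul_sub]; congr 1; abel
          _ ≤ _ := (norm_add_le _ _).trans_eq (by
              rw [norm_smul _ (g x.1 - f x.1), Real.norm_of_nonneg ENNReal.toReal_nonneg])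
    _ < ε := by rw [Finset.sum_add_distrib]; linarith

lemma hasStrongHKIntegral_zero (a b : V) :
    HasStrongHKIntegral a b (fun _ => (0 : Y)) 0 :=
  ⟨fun _ => 0, fun _ _ _ _ _ _ _ _ _ _ _ => by simp, rfl,
    fun _ hε => ⟨fun _ => 1, fun _ _ => one_pos, fun _ _ _ => by simpa using hε⟩⟩

end FiniteDimensional

section Line

/-- Cousin's covering principle on a compact interval. -/
lemma Icc_gluing_induction {a b : ℝ} (hab : a ≤ b) {Φ : ℝ → ℝ → Prop}
    (hglue : ∀ p q r, p ≤ q → q ≤ r → Φ p q → Φ q r → Φ p r)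
    (hloc : ∀ x ∈ Set.Icc a b, ∃ d > 0, ∀ p q, a ≤ p → p ≤ x → x ≤ q → q ≤ b → q - p < d →
      Φ p q) : Φ a b := by
  set S : Set ℝ := {x | x ∈ Set.Icc a b ∧ Φ a x}
  have haS : a ∈ S := by
    obtain ⟨d, hd, h⟩ := hloc a (Set.left_mem_Icc.2 hab)
    exact ⟨Set.left_mem_Icc.2 hab, h a a le_rfl le_rfl le_rfl hab (by simpa using hd)⟩
  have hbdd : BddAbove S := ⟨b, fun x hx => hx.1.2⟩
  set c := sSup S
  have hac : a ≤ c := le_csSup hbdd haS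
  have hcb : c ≤ b := csSup_le ⟨a, haS⟩ fun x hx => hx.1.2
  obtain ⟨d, hd, h⟩ := hloc c ⟨hac, hcb⟩
  obtain ⟨x, hxS, hx⟩ := exists_lt_of_lt_csSup ⟨a, haS⟩ (show c - d / 2 < sSup S by
    change c - d / 2 < c; linarith)
  have hxc : x ≤ c := le_csSup hbdd hxS
  have hcy : c ≤ min (c + d / 3) b := le_min (by linarith) hcb
  have hy : min (c + d / 3) b ∈ S := by
    refine ⟨⟨hac.trans hcy, min_le_right _ _⟩, hglue a x _ hxS.1.1 (hxc.trans hcy) hxS.2 ?_⟩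
    refine h _ _ hxS.1.1 hxc hcy (min_le_right _ _) ?_
    have := min_le_left (c + d / 3) b
    linarith
  have hyc : min (c + d / 3) b ≤ c := le_csSup hbdd hy
  have hb : min (c + d / 3) b = b := by
    rcases min_choice (c + d / 3) b with h' | h'
    · rw [h'] at hyc; linarith
    · exact h'
  rw [hb] at hy
  exact hy.2

lemma isSubinterval_Icc_iff {a b p q : ℝ} :
    IsSubinterval (Set.Icc a b) p q ↔ p < q ∧ a ≤ p ∧ q ≤ b := by
  rw [IsSubinterval, interior_Icc, Set.nonempty_Ioo]
  constructor
  · rintro ⟨h, hpq⟩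
    exact ⟨hpq, (Set.Icc_subset_Icc_iff hpq.le).1 h⟩
  · rintro ⟨hpq, h⟩
    exact ⟨Set.Icc_subset_Icc h.1 h.2, hpq⟩

lemma isHKPartition_singleton {p q t : ℝ} (hpq : p < q) (ht : t ∈ Set.Icc p q) :
    IsHKPartition (Set.Icc p q) {(t, p, q)} := by
  refine ⟨⟨?_, ?_, ?_⟩, ?_⟩
  · simp only [Finset.mem_singleton]
    rintro _ rfl
    exact ⟨ht, isSubinterval_Icc_iff.2 ⟨hpq, le_rfl, le_rfl⟩⟩
  · simp only [Finset.mem_singleton]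
    rintro _ rfl _ rfl h
    exact absurd rfl h
  · simp [itemBox]
  · simp only [Finset.mem_singleton]
    rintro _ rfl
    exact ht

lemma itemBox_disjoint_of_adjacent {p q r : ℝ} {x y : ℝ × ℝ × ℝ}
    (hx : IsSubinterval (Set.Icc p q) x.2.1 x.2.2)
    (hy : IsSubinterval (Set.Icc q r) y.2.1 y.2.2) :
    interior (itemBox x) ∩ interior (itemBox y) = ∅ := by
  rw [isSubinterval_Icc_iff] at hx hy
  simp only [itemBox, interior_Icc]
  refine Set.eq_empty_of_forall_notMem fun z hz => ?_
  obtain ⟨⟨_, h₁⟩, h₂, _⟩ := hz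
  linarith

lemma IsHKPartition.union {p q r : ℝ} (hpq : p ≤ q) (hqr : q ≤ r) {P Q : Finset (ℝ × ℝ × ℝ)}
    (hP : IsHKPartition (Set.Icc p q) P) (hQ : IsHKPartition (Set.Icc q r) Q) :
    IsHKPartition (Set.Icc p r) (P ∪ Q) := by
  have hPK : Set.Icc p q ⊆ Set.Icc p r := Set.Icc_subset_Icc_right hqr
  have hQK : Set.Icc q r ⊆ Set.Icc p r := Set.Icc_subset_Icc_left hpq
  refine ⟨⟨fun x hx => ?_, fun x hx y hy hxy => ?_, ?_⟩, fun x hx => ?_⟩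
  · rcases Finset.mem_union.1 hx with hx | hx
    · exact ⟨hPK (hP.1.1 x hx).1, (hP.1.1 x hx).2.1.trans hPK, (hP.1.1 x hx).2.2⟩
    · exact ⟨hQK (hQ.1.1 x hx).1, (hQ.1.1 x hx).2.1.trans hQK, (hQ.1.1 x hx).2.2⟩
  · rcases Finset.mem_union.1 hx with hx | hx <;> rcases Finset.mem_union.1 hy with hy | hy
    · exact hP.1.2.1 x hx y hy hxy
    · exact itemBox_disjoint_of_adjacent (hP.1.1 x hx).2 (hQ.1.1 y hy).2
    · rw [Set.inter_comm]
      exact itemBox_disjoint_of_adjacent (hP.1.1 y hy).2 (hQ.1.1 x hx).2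
    · exact hQ.1.2.1 x hx y hy hxy
  · rw [Finset.set_biUnion_union, hP.1.2.2, hQ.1.2.2, Set.Icc_union_Icc_eq_Icc hpq hqr]
  · rcases Finset.mem_union.1 hx with hx | hx
    · exact hP.2 x hx
    · exact hQ.2 x hx

lemma IsHKPartition.disjoint_of_adjacent {p q r : ℝ} {P Q : Finset (ℝ × ℝ × ℝ)}
    (hP : IsHKPartition (Set.Icc p q) P) (hQ : IsHKPartition (Set.Icc q r) Q) :
    Disjoint P Q := by
  refine Finset.disjoint_left.2 fun x hx hx' => ?_
  have h := itemBox_disjoint_of_adjacent (hP.1.1 x hx).2 (hQ.1.1 x hx').2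
  rw [Set.inter_self] at h
  exact (hP.1.1 x hx).2.2.ne_empty h

/-- If a gauge is bounded below on `N`, some fine partition of `[a, b]` has its intervals tagged
in `N` covering the part of `N` in `[a, b]`, as far as outer measure is concerned. -/
lemma exists_fine_partition_volume_le {a b : ℝ} (hab : a < b) {δ : ℝ → ℝ}
    (hδ : IsGauge (Set.Icc a b) δ) {N : Set ℝ} {m : ℝ} (hm : 0 < m) (hN : ∀ x ∈ N, m ≤ δ x) :
    ∃ P : Finset (ℝ × ℝ × ℝ), IsHKPartition (Set.Icc a b) P ∧ IsFine δ P ∧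
      volume (N ∩ Set.Icc a b) ≤ ∑ x ∈ P, N.indicator (fun _ => volume (itemBox x)) x.1 := by
  refine Icc_gluing_induction (Φ := fun p q => p < q →
    ∃ P : Finset (ℝ × ℝ × ℝ), IsHKPartition (Set.Icc p q) P ∧ IsFine δ P ∧
      volume (N ∩ Set.Icc p q) ≤ ∑ x ∈ P, N.indicator (fun _ => volume (itemBox x)) x.1)
    hab.le ?_ ?_ hab
  · intro p q r hpq hqr h₁ h₂ _
    rcases hpq.eq_or_lt with rfl | hpq'
    · exact h₂ ‹_›
    rcases hqr.eq_or_lt with rfl | hqr'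
    · exact h₁ ‹_›
    obtain ⟨P, hP, hPδ, hPN⟩ := h₁ hpq'
    obtain ⟨Q, hQ, hQδ, hQN⟩ := h₂ hqr'
    refine ⟨P ∪ Q, hP.union hpq hqr hQ, fun x hx => (Finset.mem_union.1 hx).elim (hPδ x) (hQδ x),
      ?_⟩
    rw [Finset.sum_union (hP.disjoint_of_adjacent hQ), ← Set.Icc_union_Icc_eq_Icc hpq hqr,
      Set.inter_union_distrib_left]
    exact (measure_union_le _ _).trans (add_le_add hPN hQN)
  · have hball : ∀ {p q t r : ℝ}, t ∈ Set.Icc p q → q - p < r →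
        Set.Icc p q ⊆ Metric.ball t r := fun ht hr z hz => by
      rw [Metric.mem_ball, Real.dist_eq, abs_lt]
      constructor <;> linarith [ht.1, ht.2, hz.1, hz.2]
    intro x hx
    refine ⟨min m (δ x), lt_min hm (hδ x hx), fun p q hap hpx hxq hqb hd hpq => ?_⟩
    rcases (N ∩ Set.Icc p q).eq_empty_or_nonempty with h | ⟨y, hyN, hy⟩
    · refine ⟨{(x, p, q)}, isHKPartition_singleton hpq ⟨hpx, hxq⟩, ?_, by simp [h]⟩
      simpa [IsFine, itemBox] using
        hball (r := δ x) ⟨hpx, hxq⟩ (hd.trans_le (min_le_right _ _))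
    · refine ⟨{(y, p, q)}, isHKPartition_singleton hpq hy, ?_, ?_⟩
      · simpa [IsFine, itemBox] using
          hball (r := δ y) hy (hd.trans_le ((min_le_left _ _).trans (hN y hyN)))
      · rw [Finset.sum_singleton, Set.indicator_of_mem hyN]
        exact measure_mono Set.inter_subset_right

lemma hasFinePartitions_Icc {a b : ℝ} (hab : a < b) : HasFinePartitions (Set.Icc a b) :=
  fun δ hδ => by
    obtain ⟨P, hP, hPδ, -⟩ := exists_fine_partition_volume_le hab hδ (N := ∅) one_pos (by simp)
    exact ⟨P, hP, hPδ⟩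

lemma volume_inter_Icc_eq_zero_of_gauge {a b : ℝ} (hab : a < b) {N : Set ℝ}
    (h : ∀ ε > 0, ∃ δ : ℝ → ℝ, IsGauge (Set.Icc a b) δ ∧
      ∀ P : Finset (ℝ × ℝ × ℝ), IsHKPartition (Set.Icc a b) P → IsFine δ P →
        ∑ x ∈ P, N.indicator (fun _ => (volume (itemBox x)).toReal) x.1 ≤ ε) :
    volume (N ∩ Set.Icc a b) = 0 := by
  refine le_antisymm (ENNReal.le_of_forall_pos_le_add fun ε hε _ => ?_) zero_le
  rw [zero_add]
  obtain ⟨δ, hδ, hδN⟩ := h ε hε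
  let M : ℕ → Set ℝ := fun m => {x ∈ N ∩ Set.Icc a b | 1 / ((m : ℝ) + 1) ≤ δ x}
  have hM : N ∩ Set.Icc a b = ⋃ m, M m := by
    ext x
    simp only [Set.mem_iUnion, M, Set.mem_ofPred_eq, exists_and_left]
    exact ⟨fun hx => ⟨hx, (exists_nat_one_div_lt (hδ x hx.2)).imp fun _ => le_of_lt⟩, And.left⟩
  have hmono : Monotone M := fun m n hmn x hx =>
    ⟨hx.1, (Nat.one_div_le_one_div hmn).trans hx.2⟩
  rw [hM, hmono.measure_iUnion]
  refine iSup_le fun m => ?_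
  obtain ⟨P, hP, hPδ, hPM⟩ := exists_fine_partition_volume_le hab hδ (N := M m)
    Nat.one_div_pos_of_nat fun x hx => hx.2
  have hMm : M m ∩ Set.Icc a b = M m := Set.inter_eq_left.2 fun x hx => hx.1.2
  rw [hMm] at hPM
  have htop : ∀ x ∈ P, N.indicator (fun _ => volume (itemBox x)) x.1 ≠ ⊤ := fun x _ => by
    by_cases hx : x.1 ∈ N <;> simp [hx, volume_itemBox_ne_top]
  calc volume (M m) ≤ ∑ x ∈ P, N.indicator (fun _ => volume (itemBox x)) x.1 :=
        hPM.trans (Finset.sum_le_sum fun x _ =>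
          Set.indicator_le_indicator_of_subset (fun x hx => hx.1.1) (fun _ => zero_le) _)
    _ = ENNReal.ofReal (∑ x ∈ P, N.indicator (fun _ => (volume (itemBox x)).toReal) x.1) := by
        rw [← ENNReal.ofReal_toReal (ENNReal.sum_ne_top.2 htop), ENNReal.toReal_sum htop]
        congr 1
        refine Finset.sum_congr rfl fun x _ => ?_
        by_cases hx : x.1 ∈ N <;> simp [hx]
    _ ≤ ε := by
        rw [ENNReal.ofReal_le_iff_le_toReal ENNReal.coe_ne_top]
        exact hδN P hP hPδ

end Line

section Product

/-- The product of two tagged intervals. -/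
def prodItem (x y : ℝ × ℝ × ℝ) : (ℝ × ℝ) × (ℝ × ℝ) × (ℝ × ℝ) :=
  ((x.1, y.1), (x.2.1, y.2.1), (x.2.2, y.2.2))

lemma itemBox_prodItem (x y : ℝ × ℝ × ℝ) :
    itemBox (prodItem x y) = itemBox x ×ˢ itemBox y := by
  exact Set.Icc_prod_eq _ _

/-- Fibre over each interval of `R` the partition attached to its tag. -/
noncomputable def fibrePartition (R : Finset (ℝ × ℝ × ℝ)) (P : ℝ → Finset (ℝ × ℝ × ℝ)) :
    Finset ((ℝ × ℝ) × (ℝ × ℝ) × (ℝ × ℝ)) :=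
  (R.sigma fun x => P x.1).image fun z => prodItem z.1 z.2

lemma mem_fibrePartition {R : Finset (ℝ × ℝ × ℝ)} {P : ℝ → Finset (ℝ × ℝ × ℝ)}
    {z : (ℝ × ℝ) × (ℝ × ℝ) × (ℝ × ℝ)} :
    z ∈ fibrePartition R P ↔ ∃ x ∈ R, ∃ y ∈ P x.1, prodItem x y = z := by
  simp [fibrePartition, Sigma.exists, and_assoc]

lemma sum_fibrePartition (R : Finset (ℝ × ℝ × ℝ)) (P : ℝ → Finset (ℝ × ℝ × ℝ))
    (g : (ℝ × ℝ) × (ℝ × ℝ) × (ℝ × ℝ) → ℝ) :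
    ∑ z ∈ fibrePartition R P, g z = ∑ x ∈ R, ∑ y ∈ P x.1, g (prodItem x y) := by
  rw [fibrePartition, Finset.sum_image, Finset.sum_sigma]
  rintro ⟨x, y⟩ _ ⟨x', y'⟩ _ h
  simp only [prodItem, Prod.mk.injEq] at h
  have hx : x = x' := Prod.ext h.1.1 (Prod.ext h.2.1.1 h.2.2.1)
  have hy : y = y' := Prod.ext h.1.2 (Prod.ext h.2.1.2 h.2.2.2)
  rw [hx, hy]

lemma isHKPartition_fibrePartition {a₁ b₁ a₂ b₂ : ℝ} {R : Finset (ℝ × ℝ × ℝ)}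
    {P : ℝ → Finset (ℝ × ℝ × ℝ)} (hR : IsHKPartition (Set.Icc a₁ b₁) R)
    (hP : ∀ t ∈ Set.Icc a₁ b₁, IsHKPartition (Set.Icc a₂ b₂) (P t)) :
    IsHKPartition (Set.Icc ((a₁, a₂) : ℝ × ℝ) (b₁, b₂)) (fibrePartition R P) := by
  have hK : Set.Icc ((a₁, a₂) : ℝ × ℝ) (b₁, b₂) = Set.Icc a₁ b₁ ×ˢ Set.Icc a₂ b₂ :=
    Set.Icc_prod_eq _ _
  have hP' : ∀ x ∈ R, IsHKPartition (Set.Icc a₂ b₂) (P x.1) := fun x hx => hP _ (hR.1.tag_mem hx)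
  refine ⟨⟨fun z hz => ?_, fun z hz w hw hzw => ?_, ?_⟩, fun z hz => ?_⟩
  · obtain ⟨x, hx, y, hy, rfl⟩ := mem_fibrePartition.1 hz
    have h₁ := hR.1.1 x hx
    have h₂ := (hP' x hx).1.1 y hy
    have hbox := itemBox_prodItem x y
    rw [itemBox] at hbox
    refine ⟨hK ▸ ⟨h₁.1, h₂.1⟩, ?_⟩
    rw [IsSubinterval, hbox, hK, interior_prod_eq]
    exact ⟨Set.prod_mono h₁.2.1 h₂.2.1, h₁.2.2.prod h₂.2.2⟩
  · obtain ⟨x, hx, y, hy, rfl⟩ := mem_fibrePartition.1 hz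
    obtain ⟨x', hx', y', hy', rfl⟩ := mem_fibrePartition.1 hw
    rw [itemBox_prodItem, itemBox_prodItem, interior_prod_eq, interior_prod_eq, Set.prod_inter_prod]
    by_cases h : x = x'
    · subst h
      rw [(hP' x hx).1.2.1 y hy y' hy' (fun h => hzw (by rw [h])), Set.prod_empty]
    · rw [hR.1.2.1 x hx x' hx' h, Set.empty_prod]
  · ext ⟨s, t⟩
    rw [hK, Set.mem_prod, ← hR.1.2.2]
    simp only [Set.mem_iUnion, mem_fibrePartition, exists_prop]
    constructor
    · rintro ⟨_, ⟨x, hx, y, hy, rfl⟩, hz⟩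
      rw [itemBox_prodItem] at hz
      exact ⟨⟨x, hx, hz.1⟩, (hP' x hx).1.itemBox_subset hy hz.2⟩
    · rintro ⟨⟨x, hx, hs⟩, ht⟩
      change t ∈ Set.Icc a₂ b₂ at ht
      rw [← (hP' x hx).1.2.2] at ht
      simp only [Set.mem_iUnion, exists_prop] at ht
      obtain ⟨y, hy, ht⟩ := ht
      exact ⟨_, ⟨x, hx, y, hy, rfl⟩, by rw [itemBox_prodItem]; exact ⟨hs, ht⟩⟩
  · obtain ⟨x, hx, y, hy, rfl⟩ := mem_fibrePartition.1 hz
    rw [itemBox_prodItem]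
    exact ⟨hR.2 x hx, (hP' x hx).2 y hy⟩

lemma exists_pos_forall_le {ι : Type*} (s : Finset ι) (g : ι → ℝ) (hg : ∀ i ∈ s, 0 < g i) :
    ∃ d > 0, ∀ i ∈ s, d ≤ g i := by
  rcases s.eq_empty_or_nonempty with rfl | hs
  · exact ⟨1, one_pos, by simp⟩
  · obtain ⟨i, hi, h⟩ := s.exists_min_image g hs
    exact ⟨g i, hg i hi, h⟩

lemma IsGauge.section_right {a₁ b₁ a₂ b₂ : ℝ} {δ : ℝ × ℝ → ℝ}
    (hδ : IsGauge (Set.Icc ((a₁, a₂) : ℝ × ℝ) (b₁, b₂)) δ) {t : ℝ} (ht : t ∈ Set.Icc a₁ b₁) :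
    IsGauge (Set.Icc a₂ b₂) (fun s => δ (t, s)) :=
  fun s hs => hδ (t, s) ⟨⟨ht.1, hs.1⟩, ⟨ht.2, hs.2⟩⟩

/-- Given a partition of `[a₂, b₂]` for each point of `[a₁, b₁]`, fine for the section of a gauge
`δ`, all sufficiently fine partitions of `[a₁, b₁]` give rise to `δ`-fine partitions. -/
lemma exists_gauge_isFine_fibrePartition {a₁ b₁ a₂ b₂ : ℝ} {δ : ℝ × ℝ → ℝ}
    (hδ : IsGauge (Set.Icc ((a₁, a₂) : ℝ × ℝ) (b₁, b₂)) δ) {P : ℝ → Finset (ℝ × ℝ × ℝ)}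
    (hP : ∀ t ∈ Set.Icc a₁ b₁, IsHKPartition (Set.Icc a₂ b₂) (P t) ∧
      IsFine (fun s => δ (t, s)) (P t)) :
    ∃ η : ℝ → ℝ, IsGauge (Set.Icc a₁ b₁) η ∧ ∀ R : Finset (ℝ × ℝ × ℝ),
      IsHKPartition (Set.Icc a₁ b₁) R → IsFine η R → IsFine δ (fibrePartition R P) := by
  have h : ∀ t, ∃ d : ℝ, t ∈ Set.Icc a₁ b₁ → 0 < d ∧ ∀ y ∈ P t, d ≤ δ (t, y.1) := fun t => by
    by_cases ht : t ∈ Set.Icc a₁ b₁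
    · obtain ⟨d, hd, h⟩ := exists_pos_forall_le (P t) (fun y => δ (t, y.1)) fun y hy =>
        hδ.section_right ht _ ((hP t ht).1.1.tag_mem hy)
      exact ⟨d, fun _ => ⟨hd, h⟩⟩
    · exact ⟨0, fun h => absurd h ht⟩
  choose η hη using h
  refine ⟨η, fun t ht => (hη t ht).1, fun R hR hRη z hz => ?_⟩
  obtain ⟨x, hx, y, hy, rfl⟩ := mem_fibrePartition.1 hz
  have ht := hR.1.tag_mem hx
  rw [itemBox_prodItem]
  change _ ⊆ Metric.ball (x.1, y.1) (δ (x.1, y.1))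
  rw [← ball_prod_same]
  exact Set.prod_mono ((hRη x hx).trans (Metric.ball_subset_ball ((hη x.1 ht).2 y hy)))
    ((hP x.1 ht).2 y hy)

lemma hasFinePartitions_Icc_prod {a₁ b₁ a₂ b₂ : ℝ} (hab₁ : a₁ < b₁) (hab₂ : a₂ < b₂) :
    HasFinePartitions (Set.Icc ((a₁, a₂) : ℝ × ℝ) (b₁, b₂)) := by
  intro δ hδ
  have h : ∀ t, ∃ P : Finset (ℝ × ℝ × ℝ), t ∈ Set.Icc a₁ b₁ →
      IsHKPartition (Set.Icc a₂ b₂) P ∧ IsFine (fun s => δ (t, s)) P := fun t => by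
    by_cases ht : t ∈ Set.Icc a₁ b₁
    · exact (hasFinePartitions_Icc hab₂ _ (hδ.section_right ht)).imp fun _ h _ => h
    · exact ⟨∅, fun h => absurd h ht⟩
  choose P hP using h
  obtain ⟨η, hη, h⟩ := exists_gauge_isFine_fibrePartition hδ hP
  obtain ⟨R, hR, hRη⟩ := hasFinePartitions_Icc hab₁ η hη
  exact ⟨_, isHKPartition_fibrePartition hR fun t ht => (hP t ht).1, h R hR hRη⟩

variable {Y : Type*} [NormedAddCommGroup Y]

/-- The oscillation sum of `f` over a pair of tagged partitions. -/
noncomputable def oscSum {V : Type*} [MeasureSpace V] [Preorder V] (f : V → Y)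
    (P Q : Finset (V × V × V)) : ℝ :=
  ∑ x ∈ P, ∑ y ∈ Q, ‖f x.1 - f y.1‖ * (volume (itemBox x ∩ itemBox y)).toReal

lemma sum_mul_oscSum_le_oscSum_fibrePartition (f : ℝ × ℝ → Y) (R : Finset (ℝ × ℝ × ℝ))
    (P Q : ℝ → Finset (ℝ × ℝ × ℝ)) :
    ∑ x ∈ R, (volume (itemBox x)).toReal * oscSum (fun s => f (x.1, s)) (P x.1) (Q x.1) ≤
      oscSum f (fibrePartition R P) (fibrePartition R Q) := by
  rw [oscSum, sum_fibrePartition]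
  refine Finset.sum_le_sum fun x hx => ?_
  rw [oscSum, Finset.mul_sum]
  refine Finset.sum_le_sum fun y _ => ?_
  rw [sum_fibrePartition]
  refine le_trans (le_of_eq ?_) (Finset.single_le_sum (fun x' _ => Finset.sum_nonneg fun z _ =>
    mul_nonneg (norm_nonneg _) ENNReal.toReal_nonneg) hx)
  rw [Finset.mul_sum]
  refine Finset.sum_congr rfl fun z _ => ?_
  rw [itemBox_prodItem, itemBox_prodItem, Set.prod_inter_prod, Set.inter_self,
    Measure.volume_eq_prod, Measure.prod_prod, ENNReal.toReal_mul]
  simp only [prodItem]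
  ring

theorem volume_not_propSHK_section_eq_zero {a₁ b₁ a₂ b₂ : ℝ} (hab₁ : a₁ < b₁) (hab₂ : a₂ < b₂)
    {f : ℝ × ℝ → Y} (hf : PropSHK ((a₁, a₂) : ℝ × ℝ) (b₁, b₂) f) :
    volume {t | t ∈ Set.Icc a₁ b₁ ∧ ¬ PropSHK a₂ b₂ (fun s => f (t, s))} = 0 := by
  let N : ℕ → Set ℝ := fun n => {t | ∀ δ : ℝ → ℝ, IsGauge (Set.Icc a₂ b₂) δ →
    ∃ P Q : Finset (ℝ × ℝ × ℝ), (IsHKPartition (Set.Icc a₂ b₂) P ∧ IsFine δ P) ∧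
      (IsHKPartition (Set.Icc a₂ b₂) Q ∧ IsFine δ Q) ∧
      1 / ((n : ℝ) + 1) ≤ oscSum (fun s => f (t, s)) P Q}
  have hsub : {t | t ∈ Set.Icc a₁ b₁ ∧ ¬ PropSHK a₂ b₂ (fun s => f (t, s))} ⊆
      ⋃ n, N n ∩ Set.Icc a₁ b₁ := by
    rintro t ⟨ht, hn⟩
    simp only [PropSHK, not_forall, not_exists, not_and, not_lt] at hn
    obtain ⟨ε, hε, h⟩ := hn
    obtain ⟨n, hn⟩ := exists_nat_one_div_lt hε
    refine Set.mem_iUnion.2 ⟨n, fun δ hδ => ?_, ht⟩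
    obtain ⟨P, Q, hP, hPδ, hQ, hQδ, hle⟩ := h δ hδ
    exact ⟨P, Q, ⟨hP, hPδ⟩, ⟨hQ, hQδ⟩, hn.le.trans hle⟩
  refine measure_mono_null hsub (measure_iUnion_null fun n => ?_)
  refine volume_inter_Icc_eq_zero_of_gauge hab₁ fun ε hε => ?_
  have hn : (0 : ℝ) < 1 / ((n : ℝ) + 1) := Nat.one_div_pos_of_nat
  obtain ⟨δ, hδ, hδf⟩ := hf (ε * (1 / ((n : ℝ) + 1))) (mul_pos hε hn)
  have h : ∀ t, ∃ P Q : Finset (ℝ × ℝ × ℝ), t ∈ Set.Icc a₁ b₁ →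
      (IsHKPartition (Set.Icc a₂ b₂) P ∧ IsFine (fun s => δ (t, s)) P) ∧
      (IsHKPartition (Set.Icc a₂ b₂) Q ∧ IsFine (fun s => δ (t, s)) Q) ∧
      (t ∈ N n → 1 / ((n : ℝ) + 1) ≤ oscSum (fun s => f (t, s)) P Q) := fun t => by
    by_cases ht : t ∈ Set.Icc a₁ b₁
    · by_cases htN : t ∈ N n
      · obtain ⟨P, Q, hP, hQ, h⟩ := htN _ (hδ.section_right ht)
        exact ⟨P, Q, fun _ => ⟨hP, hQ, fun _ => h⟩⟩
      · obtain ⟨P, hP⟩ := hasFinePartitions_Icc hab₂ _ (hδ.section_right ht)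
        exact ⟨P, P, fun _ => ⟨hP, hP, fun h => absurd h htN⟩⟩
    · exact ⟨∅, ∅, fun h => absurd h ht⟩
  choose P Q hPQ using h
  obtain ⟨η, hη, hηP⟩ := exists_gauge_isFine_fibrePartition hδ fun t ht => (hPQ t ht).1
  obtain ⟨θ, hθ, hθQ⟩ := exists_gauge_isFine_fibrePartition hδ fun t ht => (hPQ t ht).2.1
  refine ⟨_, hη.min hθ, fun R hR hfine => ?_⟩
  have hosc : oscSum f (fibrePartition R P) (fibrePartition R Q) < ε * (1 / ((n : ℝ) + 1)) :=
    hδf _ _ (isHKPartition_fibrePartition hR fun t ht => (hPQ t ht).1.1)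
      (hηP R hR (hfine.mono fun _ => min_le_left _ _))
      (isHKPartition_fibrePartition hR fun t ht => (hPQ t ht).2.1.1)
      (hθQ R hR (hfine.mono fun _ => min_le_right _ _))
  refine le_of_mul_le_mul_right ?_ hn
  refine le_trans ?_ ((sum_mul_oscSum_le_oscSum_fibrePartition f R P Q).trans hosc.le)
  rw [Finset.sum_mul]
  refine Finset.sum_le_sum fun x hx => ?_
  by_cases hxN : x.1 ∈ N n
  · rw [Set.indicator_of_mem hxN]
    exact mul_le_mul_of_nonneg_left ((hPQ x.1 (hR.1.tag_mem hx)).2.2 hxN) ENNReal.toReal_nonneg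
  · rw [Set.indicator_of_notMem hxN, zero_mul]
    exact mul_nonneg ENNReal.toReal_nonneg (Finset.sum_nonneg fun _ _ =>
      Finset.sum_nonneg fun _ _ => mul_nonneg (norm_nonneg _) ENNReal.toReal_nonneg)

/-- Exchange the coordinates of a tagged interval of the plane. -/
def swapItem : (ℝ × ℝ) × (ℝ × ℝ) × (ℝ × ℝ) ≃ (ℝ × ℝ) × (ℝ × ℝ) × (ℝ × ℝ) :=
  (Equiv.prodComm ℝ ℝ).prodCongr ((Equiv.prodComm ℝ ℝ).prodCongr (Equiv.prodComm ℝ ℝ))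

lemma itemBox_swapItem (x : (ℝ × ℝ) × (ℝ × ℝ) × (ℝ × ℝ)) :
    itemBox (swapItem x) = Prod.swap ⁻¹' itemBox x := by
  ext ⟨s, t⟩
  simp [itemBox, swapItem, Prod.le_def, and_comm]

lemma interior_preimage_swap (s : Set (ℝ × ℝ)) :
    interior (Prod.swap ⁻¹' s) = Prod.swap ⁻¹' interior s :=
  ((Homeomorph.prodComm ℝ ℝ).preimage_interior s).symm

lemma isHKPartition_map_swapItem {K : Set (ℝ × ℝ)} {P : Finset ((ℝ × ℝ) × (ℝ × ℝ) × (ℝ × ℝ))}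
    (hP : IsHKPartition K P) :
    IsHKPartition (Prod.swap ⁻¹' K) (P.map swapItem.toEmbedding) := by
  refine ⟨⟨fun z hz => ?_, fun z hz w hw hzw => ?_, ?_⟩, fun z hz => ?_⟩
  · obtain ⟨x, hx, rfl⟩ := Finset.mem_map.1 hz
    have h := hP.1.1 x hx
    refine ⟨by simpa [swapItem] using h.1, ?_⟩
    change itemBox (swapItem x) ⊆ _ ∧ (interior (itemBox (swapItem x))).Nonempty
    rw [itemBox_swapItem, interior_preimage_swap]
    exact ⟨Set.preimage_mono h.2.1, h.2.2.preimage Prod.swap_surjective⟩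
  · obtain ⟨x, hx, rfl⟩ := Finset.mem_map.1 hz
    obtain ⟨y, hy, rfl⟩ := Finset.mem_map.1 hw
    simp only [Equiv.coe_toEmbedding, itemBox_swapItem, interior_preimage_swap]
    rw [← Set.preimage_inter, hP.1.2.1 x hx y hy (fun h => hzw (by rw [h])), Set.preimage_empty]
  · rw [← hP.1.2.2]
    ext z
    simp only [Set.mem_iUnion, exists_prop, Finset.mem_map, Equiv.coe_toEmbedding,
      Set.preimage_iUnion, exists_exists_and_eq_and, itemBox_swapItem]
  · obtain ⟨x, hx, rfl⟩ := Finset.mem_map.1 hz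
    rw [Equiv.coe_toEmbedding, itemBox_swapItem]
    simpa [swapItem] using hP.2 x hx

lemma IsFine.map_swapItem {δ : ℝ × ℝ → ℝ} {P : Finset ((ℝ × ℝ) × (ℝ × ℝ) × (ℝ × ℝ))}
    (hP : IsFine (fun t => δ t.swap) P) : IsFine δ (P.map swapItem.toEmbedding) := by
  intro z hz
  obtain ⟨x, hx, rfl⟩ := Finset.mem_map.1 hz
  rw [Equiv.coe_toEmbedding, itemBox_swapItem]
  intro y hy
  have h := hP x hx hy
  rw [Metric.mem_ball, Prod.dist_eq] at h ⊢
  rw [max_comm]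
  exact h

lemma oscSum_map_swapItem (f : ℝ × ℝ → Y) (P Q : Finset ((ℝ × ℝ) × (ℝ × ℝ) × (ℝ × ℝ))) :
    oscSum f (P.map swapItem.toEmbedding) (Q.map swapItem.toEmbedding) =
      oscSum (fun t => f t.swap) P Q := by
  simp only [oscSum, Finset.sum_map, Equiv.coe_toEmbedding, itemBox_swapItem]
  refine Finset.sum_congr rfl fun x _ => Finset.sum_congr rfl fun y _ => ?_
  rw [← Set.preimage_inter]
  congr 2
  exact (Measure.measurePreserving_swap (μ := (volume : Measure ℝ))
    (ν := (volume : Measure ℝ))).measure_preimage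
    ((measurableSet_itemBox x).inter (measurableSet_itemBox y)).nullMeasurableSet

lemma PropSHK.swap {a₁ b₁ a₂ b₂ : ℝ} {f : ℝ × ℝ → Y}
    (hf : PropSHK ((a₁, a₂) : ℝ × ℝ) (b₁, b₂) f) :
    PropSHK ((a₂, a₁) : ℝ × ℝ) (b₂, b₁) (fun t => f t.swap) := by
  have hK : Set.Icc ((a₁, a₂) : ℝ × ℝ) (b₁, b₂) =
      Prod.swap ⁻¹' Set.Icc ((a₂, a₁) : ℝ × ℝ) (b₂, b₁) := by
    rw [Set.Icc_prod_eq, Set.Icc_prod_eq, Set.preimage_swap_prod]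
  intro ε hε
  obtain ⟨δ, hδ, h⟩ := hf ε hε
  refine ⟨fun t => δ t.swap, fun t ht => hδ _ (by rw [hK]; simpa using ht),
    fun P Q hP hPδ hQ hQδ => ?_⟩
  rw [hK] at h
  exact (oscSum_map_swapItem f P Q).symm.trans_lt
    (h _ _ (isHKPartition_map_swapItem hP) hPδ.map_swapItem (isHKPartition_map_swapItem hQ)
      hQδ.map_swapItem)

end Product

/-- Theorem 2.2(i): `f₀ = f·𝟙_{[a,b]∖Z}` is strongly integrable
and all of its sections are strongly integrable. -/
theorem fubini_main_hk_integrable {X : Type*} [NormedAddCommGroup X] [NormedSpace ℝ X] [CompleteSpace X] (a₁ b₁ a₂ b₂ : ℝ) (hab₁ : a₁ < b₁) (hab₂ : a₂ < b₂)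
    (f : ℝ × ℝ → X) (v : X)
    (hfS : PropSHK ((a₁, a₂) : ℝ × ℝ) (b₁, b₂) f)
    (hf : HasHKIntegral (Set.Icc ((a₁, a₂) : ℝ × ℝ) (b₁, b₂)) f v)
    (Z₁ : Set ℝ) (hZ₁ : Z₁ = {t₁ : ℝ | t₁ ∈ Set.Icc a₁ b₁ ∧ ¬ PropSHK a₂ b₂ (fun s₂ => f (t₁, s₂))})
    (Z₂ : Set ℝ) (hZ₂ : Z₂ = {t₂ : ℝ | t₂ ∈ Set.Icc a₂ b₂ ∧ ¬ PropSHK a₁ b₁ (fun s₁ => f (s₁, t₂))})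
    (Z : Set (ℝ × ℝ)) (hZ : Z = (Z₁ ×ˢ Set.Icc a₂ b₂) ∪ ((Set.Icc a₁ b₁) ×ˢ Z₂))
    (f₀ : ℝ × ℝ → X) (hf₀ : f₀ = ((Set.Icc ((a₁, a₂) : ℝ × ℝ) (b₁, b₂)) \ Z).indicator f) :
    (∃ v₀ : X, HasStrongHKIntegral ((a₁, a₂) : ℝ × ℝ) (b₁, b₂) f₀ v₀) ∧
    (∀ t₁ ∈ Set.Icc a₁ b₁, ∃ u : X, HasStrongHKIntegral a₂ b₂ (fun s₂ => f₀ (t₁, s₂)) u) ∧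
    (∀ t₂ ∈ Set.Icc a₂ b₂, ∃ u : X, HasStrongHKIntegral a₁ b₁ (fun s₁ => f₀ (s₁, t₂)) u) := by
  have hK : Set.Icc ((a₁, a₂) : ℝ × ℝ) (b₁, b₂) = Set.Icc a₁ b₁ ×ˢ Set.Icc a₂ b₂ :=
    Set.Icc_prod_eq _ _
  have hZ₁0 : volume Z₁ = 0 := hZ₁ ▸ volume_not_propSHK_section_eq_zero hab₁ hab₂ hfS
  have hZ₂0 : volume Z₂ = 0 := by
    have h := volume_not_propSHK_section_eq_zero hab₂ hab₁ hfS.swap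
    simp only [Prod.swap_prod_mk] at h
    rwa [hZ₂]
  have hZ0 : volume Z = 0 := by
    rw [hZ, Measure.volume_eq_prod]
    exact measure_union_null (by rw [Measure.prod_prod, hZ₁0, zero_mul])
      (by rw [Measure.prod_prod, hZ₂0, mul_zero])
  have hin : ∀ t₁ ∈ Set.Icc a₁ b₁, ∀ t₂ ∈ Set.Icc a₂ b₂, t₁ ∉ Z₁ → t₂ ∉ Z₂ →
      f₀ (t₁, t₂) = f (t₁, t₂) := fun t₁ h₁ t₂ h₂ hn₁ hn₂ => by
    rw [hf₀, Set.indicator_of_mem]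
    rw [hK, hZ]
    exact ⟨⟨h₁, h₂⟩, fun h => h.elim (fun h => hn₁ h.1) (fun h => hn₂ h.2)⟩
  have hout : ∀ t₁ ∈ Set.Icc a₁ b₁, ∀ t₂ ∈ Set.Icc a₂ b₂, t₁ ∈ Z₁ ∨ t₂ ∈ Z₂ →
      f₀ (t₁, t₂) = 0 := fun t₁ h₁ t₂ h₂ h => by
    rw [hf₀, Set.indicator_of_notMem]
    rw [hZ]
    exact fun hn => hn.2 (h.imp (fun h => ⟨h, h₂⟩) (fun h => ⟨h₁, h⟩))
  refine ⟨?_, fun t₁ h₁ => ?_, fun t₂ h₂ => ?_⟩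
  · obtain ⟨w, hw⟩ := hfS.exists_hasStrongHKIntegral (hasFinePartitions_Icc_prod hab₁ hab₂)
    refine ⟨w, hw.congr_of_null hZ0 fun t ht => ?_⟩
    rw [hf₀, Set.indicator_of_mem ht]
  · by_cases ht : t₁ ∈ Z₁
    · exact ⟨0, (hasStrongHKIntegral_zero a₂ b₂).congr_of_null hZ₂0 fun t₂ h₂ =>
        hout t₁ h₁ t₂ h₂.1 (Or.inl ht)⟩
    · have hS : PropSHK a₂ b₂ (fun s₂ => f (t₁, s₂)) := by
        by_contra hS
        exact ht (hZ₁ ▸ ⟨h₁, hS⟩)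
      obtain ⟨w, hw⟩ := hS.exists_hasStrongHKIntegral (hasFinePartitions_Icc hab₂)
      exact ⟨w, hw.congr_of_null hZ₂0 fun t₂ h₂ => hin t₁ h₁ t₂ h₂.1 ht h₂.2⟩
  · by_cases ht : t₂ ∈ Z₂
    · exact ⟨0, (hasStrongHKIntegral_zero a₁ b₁).congr_of_null hZ₁0 fun t₁ h₁ =>
        hout t₁ h₁.1 t₂ h₂ (Or.inr ht)⟩
    · have hS : PropSHK a₁ b₁ (fun s₁ => f (s₁, t₂)) := by
        by_contra hS
        exact ht (hZ₂ ▸ ⟨h₂, hS⟩)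
      obtain ⟨w, hw⟩ := hS.exists_hasStrongHKIntegral (hasFinePartitions_Icc hab₁)
      exact ⟨w, hw.congr_of_null hZ₁0 fun t₁ h₁ => hin t₁ h₁.1 t₂ h₂ h₁.2 ht⟩
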